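/- Consider the set 𝒢 of congestion games with at most n users and resource cost functions in 𝓛 for positive, convex, nondecreasing basis functions b_1,…,b_m. For each j ∈ {1,…,m} let (F*_j, ρ*_j) be an optimal solution of the linear program: maximize ρ over F : {1,…,n+1} → ℝ with F(n+1) = 0 and ρ ∈ ℝ, subject to b_j(y)·y − ρ·b_j(x)·x + F(x)·(x−z) − F(x+1)·(y−z) ≥ 0 for all (x,y,z) ∈ I(n), where b_j(0) = F(0) = 0. Then the linear local mechanism T* defined by T*(Σ_j α_j b_j) = Σ_j α_j (F*_j − b_j) satisfies PoS(T*) = PoA(T*) = max_{j} 1/ρ*_j. -/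

import Mathlib

open scoped BigOperators ENNReal

noncomputable section

/-- A congestion game with incentives: `n` users, `R` resources,
finite nonempty action sets `act i ⊆ 2^E`, resource cost functions `cost e`
and incentive functions `tax e`. -/
structure CGame where
  n : ℕ
  R : ℕ
  act : Fin n → Finset (Finset (Fin R))
  act_ne : ∀ i, (act i).Nonempty
  cost : Fin R → ℕ → ℝ
  tax : Fin R → ℕ → ℝ

namespace CGame

variable (G : CGame)

/-- An assignment of actions (not necessarily feasible). -/
abbrev Assign := Fin G.n → Finset (Fin G.R)

/-- Feasibility of an assignment. -/
def IsAssign (a : G.Assign) : Prop := ∀ i, a i ∈ G.act i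

/-- The load `|a|_e`: the number of users selecting resource `e`. -/
def load (a : G.Assign) (e : Fin G.R) : ℕ :=
  (Finset.univ.filter fun i => e ∈ a i).card

/-- The social cost `SC(a)`. -/
def SC (a : G.Assign) : ℝ := ∑ i, ∑ e ∈ a i, G.cost e (G.load a e)

/-- The cost `C_i(a)` experienced by user `i` (resource costs plus incentives). -/
def userCost (i : Fin G.n) (a : G.Assign) : ℝ :=
  ∑ e ∈ a i, (G.cost e (G.load a e) + G.tax e (G.load a e))

/-- Pure Nash equilibrium. -/
def IsNE (a : G.Assign) : Prop :=
  G.IsAssign a ∧ ∀ i : Fin G.n, ∀ s ∈ G.act i,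
    G.userCost i a ≤ G.userCost i (Function.update a i s)

/-- The Rosenthal potential of the game with incentives. -/
def potential (a : G.Assign) : ℝ :=
  ∑ e, ∑ k ∈ Finset.Icc 1 (G.load a e), (G.cost e k + G.tax e k)

/-- The minimum achievable social cost. -/
def MinCost : ℝ := sInf {c | ∃ a, G.IsAssign a ∧ G.SC a = c}

end CGame

/-- A (local) incentive mechanism: a map from resource cost functions to
incentive functions. -/
abbrev Mech : Type := (ℕ → ℝ) → (ℕ → ℝ)

/-- Membership of a game in the class `𝒢` of congestion games with at most `n`
users, resource cost functions that are nonnegative linear combinations of the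
basis functions `b`, and incentives generated by the mechanism `T`. -/
def InClass (n m : ℕ) (b : Fin m → ℕ → ℝ) (T : Mech) (G : CGame) : Prop :=
  G.n ≤ n ∧
  (∀ e, ∃ α : Fin m → ℝ, (∀ j, 0 ≤ α j) ∧ ∀ x, G.cost e x = ∑ j, α j * b j x) ∧
  (∀ e x, G.tax e x = T (G.cost e) x)

/-- Price of anarchy of mechanism `T` over the class of congestion games with
at most `n` users and costs generated by the basis `b`. -/
def PoA (n m : ℕ) (b : Fin m → ℕ → ℝ) (T : Mech) : ℝ≥0∞ :=
  ⨆ G : CGame, ⨆ _ : InClass n m b T G ∧ 0 < G.MinCost,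
    ⨆ a : G.Assign, ⨆ _ : G.IsNE a, ENNReal.ofReal (G.SC a / G.MinCost)

/-- Price of stability of mechanism `T` over the class of congestion games with
at most `n` users and costs generated by the basis `b`. -/
def PoS (n m : ℕ) (b : Fin m → ℕ → ℝ) (T : Mech) : ℝ≥0∞ :=
  ⨆ G : CGame, ⨆ _ : InClass n m b T G ∧ 0 < G.MinCost,
    ⨅ a : {a : G.Assign // G.IsNE a}, ENNReal.ofReal (G.SC a.1 / G.MinCost)

/-- The marginal cost mechanism `T^mc(ℓ)(x) = (x−1)·[ℓ(x) − ℓ(x−1)]`. -/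
def Tmc : Mech := fun ℓ x => ((x : ℝ) - 1) * (ℓ x - ℓ (x - 1))

/-- Feasibility in the linear program of Proposition 2.1 (Paccagnan et al.):
`(F, ρ)` is feasible for basis function `b` and `n` users if `F(0) = F(n+1) = 0`
and `b(y)·y − ρ·b(x)·x + F(x)·(x−z) − F(x+1)·(y−z) ≥ 0` for all
`(x, y, z) ∈ I(n)`, i.e. all naturals with `z ≤ min{x,y}` and
`1 ≤ x + y − z ≤ n`. -/
def FeasPoA (n : ℕ) (b : ℕ → ℝ) (F : ℕ → ℝ) (ρ : ℝ) : Prop :=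
  F 0 = 0 ∧ F (n + 1) = 0 ∧
  ∀ x y z : ℕ, x ≤ n → y ≤ n → z ≤ x → z ≤ y → 1 ≤ x + y - z → x + y - z ≤ n →
    b y * y - ρ * (b x * x) + F x * ((x : ℝ) - (z : ℝ))
      - F (x + 1) * ((y : ℝ) - (z : ℝ)) ≥ 0

/-- The hypotheses on a basis function: it vanishes at `0` and is positive, nondecreasing and
convex on `{1, …, n}`. -/
structure IsBasisFun (n : ℕ) (b : ℕ → ℝ) : Prop where
  zero : b 0 = 0
  pos : ∀ x : ℕ, 1 ≤ x → x ≤ n → 0 < b x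
  mono : ∀ x : ℕ, 1 ≤ x → x < n → b x ≤ b (x + 1)
  conv : ∀ x : ℕ, 1 ≤ x → x + 1 ≤ n → b x - b (x - 1) ≤ b (x + 1) - b x

namespace IsBasisFun

variable {n : ℕ} {b : ℕ → ℝ}

lemma nonneg (hb : IsBasisFun n b) {x : ℕ} (hx : x ≤ n) : 0 ≤ b x := by
  rcases Nat.eq_zero_or_pos x with rfl | h
  · exact hb.zero.ge
  · exact (hb.pos x h hx).le

lemma le_succ (hb : IsBasisFun n b) {x : ℕ} (hx : x < n) : b x ≤ b (x + 1) := by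
  rcases Nat.eq_zero_or_pos x with rfl | h
  · rw [hb.zero]; exact hb.nonneg hx
  · exact hb.mono x h hx

lemma monotone (hb : IsBasisFun n b) {x y : ℕ} (hxy : x ≤ y) (hy : y ≤ n) : b x ≤ b y := by
  induction y, hxy using Nat.le_induction with
  | base => exact le_rfl
  | succ y _ ih => exact (ih (by omega)).trans (hb.le_succ hy)

lemma total_nonneg (hb : IsBasisFun n b) {x : ℕ} (hx : x ≤ n) : 0 ≤ b x * x :=
  mul_nonneg (hb.nonneg hx) (Nat.cast_nonneg _)

lemma total_pos (hb : IsBasisFun n b) {x : ℕ} (hx0 : 1 ≤ x) (hx : x ≤ n) : 0 < b x * x :=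
  mul_pos (hb.pos x hx0 hx) (by exact_mod_cast hx0)

/-- The marginal total cost of adding one user to `k` users. -/
def marginal (b : ℕ → ℝ) (k : ℕ) : ℝ := b (k + 1) * ((k : ℝ) + 1) - b k * k

lemma marginal_le_succ (hb : IsBasisFun n b) {k : ℕ} (hk : k + 2 ≤ n) :
    marginal b k ≤ marginal b (k + 1) := by
  have h1 := hb.conv (k + 1) (by omega) hk
  have h2 := hb.le_succ (x := k) (by omega)
  have h3 := hb.le_succ (x := k + 1) (by omega)
  simp only [Nat.add_sub_cancel] at h1
  have hk0 : (0 : ℝ) ≤ k := Nat.cast_nonneg _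
  unfold marginal
  push_cast
  nlinarith [mul_nonneg hk0 (sub_nonneg.2 h1)]

lemma marginal_mono (hb : IsBasisFun n b) {k l : ℕ} (hkl : k ≤ l) (hl : l < n) :
    marginal b k ≤ marginal b l := by
  induction l, hkl using Nat.le_induction with
  | base => exact le_rfl
  | succ l _ ih => exact (ih (by omega)).trans (hb.marginal_le_succ (by omega))

lemma marginal_pos (hb : IsBasisFun n b) {k : ℕ} (hk : k < n) : 0 < marginal b k := by
  have h := hb.marginal_mono (Nat.zero_le k) hk
  have h1 := hb.pos 1 le_rfl (by omega)
  simp only [marginal, hb.zero] at h ⊢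
  norm_num at h
  linarith

/-- Total costs grow from `u` at least as fast as any earlier marginal cost. -/
lemma marginal_mul_le (hb : IsBasisFun n b) {k u v : ℕ} (hku : k ≤ u) (huv : u ≤ v)
    (hv : v ≤ n) : marginal b k * ((v : ℝ) - u) ≤ b v * v - b u * u := by
  induction v, huv using Nat.le_induction with
  | base => simp
  | succ v huv ih =>
    have h1 := ih (by omega)
    have h2 := hb.marginal_mono (k := k) (l := v) (by omega) (by omega)
    have h3 : marginal b v = b (v + 1) * ((v : ℝ) + 1) - b v * v := rfl
    push_cast
    linarith

/-- Total costs grow up to `v` at most as fast as any later marginal cost. -/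
lemma le_marginal_mul (hb : IsBasisFun n b) {k u v : ℕ} (huv : u ≤ v) (hvk : v ≤ k + 1)
    (hk : k < n) : b v * v - b u * u ≤ marginal b k * ((v : ℝ) - u) := by
  induction v, huv using Nat.le_induction with
  | base => simp
  | succ v huv ih =>
    have h1 := ih (by omega)
    have h2 := hb.marginal_mono (k := v) (l := k) (by omega) hk
    have h3 : marginal b v = b (v + 1) * ((v : ℝ) + 1) - b v * v := rfl
    push_cast
    linarith

end IsBasisFun

/-- Membership of `(x, y, z)` in the index set `I(n)`. -/
def InIndex (n x y z : ℕ) : Prop :=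
  x ≤ n ∧ y ≤ n ∧ z ≤ x ∧ z ≤ y ∧ 1 ≤ x + y - z ∧ x + y - z ≤ n

/-- The left-hand side of the `(x, y, z)` constraint of the linear program. -/
def slack (b F : ℕ → ℝ) (ρ : ℝ) (x y z : ℕ) : ℝ :=
  b y * y - ρ * (b x * x) + F x * ((x : ℝ) - z) - F (x + 1) * ((y : ℝ) - z)

/-- The `(x, y, z)` constraint belongs to the linear program and is active at `(F, ρ)`. -/
def Tight (n : ℕ) (b F : ℕ → ℝ) (ρ : ℝ) (x y z : ℕ) : Prop :=
  InIndex n x y z ∧ slack b F ρ x y z = 0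

section LinearProgram

variable {n : ℕ} {b F : ℕ → ℝ} {ρ : ℝ}

lemma FeasPoA.slack_nonneg (hF : FeasPoA n b F ρ) {x y z : ℕ} (h : InIndex n x y z) :
    0 ≤ slack b F ρ x y z := by
  obtain ⟨h1, h2, h3, h4, h5, h6⟩ := h
  exact hF.2.2 x y z h1 h2 h3 h4 h5 h6

lemma feasPoA_of_slack_nonneg (h0 : F 0 = 0) (hn : F (n + 1) = 0)
    (h : ∀ x y z, InIndex n x y z → 0 ≤ slack b F ρ x y z) : FeasPoA n b F ρ :=
  ⟨h0, hn, fun x y z h1 h2 h3 h4 h5 h6 => h x y z ⟨h1, h2, h3, h4, h5, h6⟩⟩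

lemma FeasPoA.le_one (hb : IsBasisFun n b) (hn : 0 < n) (hF : FeasPoA n b F ρ) : ρ ≤ 1 := by
  have h := hF.slack_nonneg (x := 1) (y := 1) (z := 1)
    ⟨hn, hn, le_rfl, le_rfl, by omega, by omega⟩
  have h1 := hb.pos 1 le_rfl hn
  simp only [slack] at h
  norm_num at h
  nlinarith

lemma FeasPoA.apply_one_le (hb : IsBasisFun n b) (hn : 0 < n) (hF : FeasPoA n b F ρ) :
    F 1 ≤ b 1 := by
  have h := hF.slack_nonneg (x := 0) (y := 1) (z := 0)
    ⟨by omega, hn, by omega, by omega, by omega, by omega⟩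
  simp only [slack, hF.1, hb.zero] at h
  norm_num at h
  exact h

/-- A constant incentivized cost is feasible, so the optimal value is positive. -/
lemma exists_feasPoA_pos (hb : IsBasisFun n b) (hn : 0 < n) :
    ∃ F ρ, 0 < ρ ∧ FeasPoA n b F ρ := by
  have h1 := hb.pos 1 le_rfl hn
  have hbn := hb.pos n hn le_rfl
  refine ⟨fun k => if 1 ≤ k ∧ k ≤ n then b 1 else 0, b 1 / b n, div_pos h1 hbn,
    feasPoA_of_slack_nonneg (by simp) (by simp) ?_⟩
  rintro x y z ⟨hx, hy, hzx, hzy, h5, h6⟩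
  have hFx : (if 1 ≤ x ∧ x ≤ n then b 1 else 0) * ((x : ℝ) - z) = b 1 * ((x : ℝ) - z) := by
    rcases Nat.eq_zero_or_pos x with rfl | hx0
    · obtain rfl : z = 0 := by omega
      simp
    · rw [if_pos ⟨hx0, hx⟩]
  have hFy : (if 1 ≤ x + 1 ∧ x + 1 ≤ n then b 1 else 0) * ((y : ℝ) - z)
      = b 1 * ((y : ℝ) - z) := by
    rcases Nat.lt_or_ge x n with hxn | hxn
    · rw [if_pos ⟨by omega, hxn⟩]
    · obtain rfl : y = z := by omega
      simp
  have hyb : b 1 * y ≤ b y * y := by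
    rcases Nat.eq_zero_or_pos y with rfl | hy0
    · simp
    · exact mul_le_mul_of_nonneg_right (hb.monotone hy0 hy) (Nat.cast_nonneg _)
  have hxb : b 1 / b n * (b x * x) ≤ b 1 * x := by
    rw [div_mul_eq_mul_div, div_le_iff₀ hbn]
    have := mul_le_mul_of_nonneg_right (hb.monotone hx le_rfl) (Nat.cast_nonneg (α := ℝ) x)
    nlinarith
  simp only [slack, hFx, hFy]
  linarith

lemma FeasPoA.mul_lt_of_lt (hb : IsBasisFun n b) (hF : FeasPoA n b F ρ) (hρ : ρ < 1)
    {k y : ℕ} (hk : 1 ≤ k) (hky : k < y) (hy : y ≤ n) :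
    F k * ((y : ℝ) - k) < b y * y - ρ * (b k * k) := by
  obtain ⟨j, rfl⟩ : ∃ j, k = j + 1 := ⟨k - 1, by omega⟩
  have h := hF.slack_nonneg (x := j) (y := y) (z := j)
    ⟨by omega, hy, le_rfl, by omega, by omega, by omega⟩
  have h1 := hb.marginal_mul_le (k := j) (u := j + 1) (by omega) hky.le hy
  have h2 := hb.total_pos hk (hky.le.trans hy)
  have h3 := hb.marginal_pos (k := j) (by omega)
  have h4 : IsBasisFun.marginal b j = b (j + 1) * ((j : ℝ) + 1) - b j * j := rfl
  have hm : (0 : ℝ) < (y : ℝ) - (j + 1 : ℕ) := sub_pos.2 (by exact_mod_cast hky)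
  simp only [slack, sub_self, mul_zero] at h
  by_contra! hc
  have h5 : F (j + 1) ≤ ρ * IsBasisFun.marginal b j := by
    rw [h4]; push_cast at *; linarith
  have h6 : F (j + 1) < IsBasisFun.marginal b j := h5.trans_lt (by nlinarith)
  have h7 := mul_lt_mul_of_pos_right h6 hm
  nlinarith

lemma FeasPoA.le_succ_of_tight (hb : IsBasisFun n b) (hF : FeasPoA n b F ρ) (hρ : ρ < 1)
    {k y z : ℕ} (ht : Tight n b F ρ k y z) (hzy : z < y) : F k ≤ F (k + 1) := by
  obtain ⟨⟨hk, hy, hzk, -, h5, h6⟩, hs⟩ := ht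
  have key : 0 ≤ b y * y - ρ * (b k * k) + F k * ((k : ℝ) - y) := by
    rcases lt_trichotomy y k with h | h | h
    · have := hF.slack_nonneg (x := k) (y := y) (z := y)
        ⟨hk, hy, h.le, le_rfl, by omega, by omega⟩
      simpa [slack] using this
    · subst h
      have := hb.total_nonneg hy
      nlinarith
    · rcases Nat.eq_zero_or_pos k with rfl | hk0
      · have := hb.total_nonneg hy
        simpa [hF.1] using this
      · have := hF.mul_lt_of_lt hb hρ hk0 h hy
        linarith
  have hyz : (0 : ℝ) < (y : ℝ) - z := sub_pos.2 (by exact_mod_cast hzy)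
  unfold slack at hs
  refine le_of_mul_le_mul_right ?_ hyz
  linarith

/-- `TightChain n b F ρ j x`: the values `F (j+1), …, F x` are successively linked by active
constraints, the first of which does not involve `F j`. -/
inductive TightChain (n : ℕ) (b F : ℕ → ℝ) (ρ : ℝ) (j : ℕ) : ℕ → Prop
  | start {y : ℕ} (ht : Tight n b F ρ j y j) (hy : j < y) : TightChain n b F ρ j (j + 1)
  | step {x y z : ℕ} (hc : TightChain n b F ρ j x) (ht : Tight n b F ρ x y z) (hzy : z < y) :
      TightChain n b F ρ j (x + 1)

lemma TightChain.bounds {j x : ℕ} (hc : TightChain n b F ρ j x) : j < x ∧ x ≤ n := by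
  induction hc with
  | start ht hy => obtain ⟨⟨h1, h2, h3, h4, h5, h6⟩, -⟩ := ht; omega
  | step _ ht hzy ih => obtain ⟨⟨h1, h2, h3, h4, h5, h6⟩, -⟩ := ht; omega

lemma TightChain.exists_start {j x : ℕ} (hc : TightChain n b F ρ j x) :
    ∃ y, j < y ∧ Tight n b F ρ j y j := by
  induction hc with
  | start ht hy => exact ⟨_, hy, ht⟩
  | step _ _ _ ih => exact ih

lemma TightChain.le (hb : IsBasisFun n b) (hF : FeasPoA n b F ρ) (hρ : ρ < 1) {j x : ℕ}
    (hc : TightChain n b F ρ j x) {k : ℕ} (hjk : j ≤ k) (hkx : k ≤ x) : F k ≤ F x := by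
  induction hc with
  | start ht hy =>
    obtain rfl | rfl : k = j ∨ k = j + 1 := by omega
    · exact hF.le_succ_of_tight hb hρ ht hy
    · exact le_rfl
  | step _ ht hzy ih =>
    rcases hkx.lt_or_eq with h | rfl
    · exact (ih (by omega)).trans (hF.le_succ_of_tight hb hρ ht hzy)
    · exact le_rfl

lemma TightChain.start_eq_zero (hb : IsBasisFun n b) (hF : FeasPoA n b F ρ) (hρ : ρ < 1)
    {j x y : ℕ} (hc : TightChain n b F ρ j x) (hyx : y < x) (ht : Tight n b F ρ x y y) :
    j = 0 := by
  by_contra hj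
  obtain ⟨hjx, hxn⟩ := hc.bounds
  obtain ⟨i, rfl⟩ : ∃ i, j = i + 1 := ⟨j - 1, by omega⟩
  obtain ⟨l, rfl⟩ : ∃ l, n = l + 1 := ⟨n - 1, by omega⟩
  have hle := hc.le hb hF hρ le_rfl hjx.le
  obtain ⟨w, hw, htw⟩ := hc.exists_start
  have hwn : w ≤ l + 1 := htw.1.2.1
  have hlt : F x < IsBasisFun.marginal b l := by
    have h1 := hb.le_marginal_mul (k := l) hyx.le hxn (by omega)
    have h2 := ht.2
    have h3 := hb.total_pos (x := x) (by omega) hxn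
    simp only [slack, sub_self, mul_zero] at h2
    have hm : (0 : ℝ) < (x : ℝ) - y := sub_pos.2 (by exact_mod_cast hyx)
    refine lt_of_mul_lt_mul_right ?_ hm.le
    nlinarith
  have hs := htw.2
  simp only [slack, sub_self, mul_zero] at hs
  rcases hwn.lt_or_eq with h | rfl
  · have h1 := hF.slack_nonneg (x := i + 1) (y := w) (z := i)
      ⟨by omega, by omega, by omega, by omega, by omega, by omega⟩
    have h2 := hF.mul_lt_of_lt hb hρ (k := i + 1) (by omega) hw hwn
    have hm : (0 : ℝ) < (w : ℝ) - (i + 1 : ℕ) := sub_pos.2 (by exact_mod_cast hw)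
    have h3 : F (i + 1) < F (i + 1 + 1) := by
      refine lt_of_mul_lt_mul_right ?_ hm.le
      linarith
    simp only [slack] at h1
    push_cast at *
    nlinarith
  · have h1 := hF.slack_nonneg (x := i + 1) (y := l) (z := i)
      ⟨by omega, by omega, by omega, by omega, by omega, by omega⟩
    have h4 : IsBasisFun.marginal b l = b (l + 1) * ((l : ℝ) + 1) - b l * l := rfl
    simp only [slack] at h1
    push_cast at *
    nlinarith

lemma eventually_add_mul_pos {g s : ℝ} (hg : 0 ≤ g) (hs : g = 0 → 0 < s) :
    ∀ᶠ t : ℝ in nhdsWithin 0 (Set.Ioi 0), 0 < g + t * s := by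
  rcases hg.lt_or_eq with h | h
  · have hc : Filter.Tendsto (fun t : ℝ => g + t * s) (nhdsWithin 0 (Set.Ioi 0)) (nhds g) := by
      have : Continuous (fun t : ℝ => g + t * s) := by fun_prop
      simpa using (this.tendsto 0).mono_left nhdsWithin_le_nhds
    exact hc.eventually_const_lt h
  · filter_upwards [self_mem_nhdsWithin] with t ht
    rw [← h, zero_add]
    exact mul_pos ht (hs h.symm)

lemma eventually_forall_inIndex {P : ℝ → ℕ → ℕ → ℕ → Prop} {l : Filter ℝ}
    (h : ∀ x y z, InIndex n x y z → ∀ᶠ t in l, P t x y z) :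
    ∀ᶠ t in l, ∀ x y z, InIndex n x y z → P t x y z := by
  have hfin : {p : ℕ × ℕ × ℕ | InIndex n p.1 p.2.1 p.2.2}.Finite := by
    refine ((Set.finite_Iic n).prod ((Set.finite_Iic n).prod (Set.finite_Iic n))).subset ?_
    rintro ⟨x, y, z⟩ ⟨h1, h2, h3, -⟩
    exact ⟨h1, h2, h3.trans h1⟩
  have := (Filter.eventually_all_finite hfin (p := fun p t => P t p.1 p.2.1 p.2.2)).2
    fun p hp => h _ _ _ hp
  filter_upwards [this] with t ht x y z hx
  exact ht (x, y, z) hx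

/-- No direction strictly improves every active constraint at an optimal solution. -/
lemma FeasPoA.not_improving (hF : FeasPoA n b F ρ)
    (hopt : ∀ F' ρ', FeasPoA n b F' ρ' → ρ' ≤ ρ) (d : ℕ → ℝ) (hd0 : d 0 = 0)
    (hdn : d (n + 1) = 0) :
    ¬ ∀ x y z, Tight n b F ρ x y z → 0 < d x * ((x : ℝ) - z) - d (x + 1) * ((y : ℝ) - z) := by
  intro h
  obtain ⟨t, ht⟩ := (eventually_forall_inIndex (n := n) (l := nhdsWithin 0 (Set.Ioi 0))
    (P := fun t x y z => 0 < slack b F ρ x y z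
      + t * (d x * ((x : ℝ) - z) - d (x + 1) * ((y : ℝ) - z)))
    fun x y z hx => eventually_add_mul_pos (hF.slack_nonneg hx)
      fun h0 => h x y z ⟨hx, h0⟩).exists
  obtain ⟨δ, hδ, hδ0⟩ := ((eventually_forall_inIndex (n := n) (l := nhdsWithin 0 (Set.Ioi 0))
    (P := fun δ x y z => 0 < slack b F ρ x y z
      + t * (d x * ((x : ℝ) - z) - d (x + 1) * ((y : ℝ) - z)) + δ * (-(b x * x)))
    fun x y z hx => eventually_add_mul_pos (ht x y z hx).le
      fun h0 => absurd h0 (ht x y z hx).ne').and self_mem_nhdsWithin).exists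
  have := hopt (fun k => F k + t * d k) (ρ + δ) (feasPoA_of_slack_nonneg
    (by simp [hF.1, hd0]) (by simp [hF.2.1, hdn]) fun x y z hx => by
      have := hδ x y z hx
      simp only [slack] at this ⊢
      linarith)
  have hδ0' : 0 < δ := hδ0
  linarith

open Classical in
/-- At an optimal solution some equilibrium-side active constraint is reached by a chain. -/
lemma FeasPoA.exists_chain (hb : IsBasisFun n b) (hF : FeasPoA n b F ρ) (hρ : ρ < 1)
    (hopt : ∀ F' ρ', FeasPoA n b F' ρ' → ρ' ≤ ρ) :
    ∃ j x y, TightChain n b F ρ j x ∧ y < x ∧ Tight n b F ρ x y y := by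
  by_contra! hno
  set N : ℕ → Prop := fun x => ∃ j, TightChain n b F ρ j x with hN
  have hM : (0 : ℝ) < (n : ℝ) + 1 := by positivity
  set d : ℕ → ℝ := fun x => if x = 0 ∨ n < x then 0 else
    if N x then -((n : ℝ) + 1) ^ x else (((n : ℝ) + 1) ^ x)⁻¹ with hd
  refine hF.not_improving hopt d (by simp [hd]) (by simp [hd]) ?_
  intro x y z ht
  have ⟨⟨hx, hy, hzx, hzy, h5, h6⟩, hs⟩ := ht
  have hneg : ∀ k, N k → d k = -((n : ℝ) + 1) ^ k := by
    rintro k ⟨j, hk⟩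
    have := hk.bounds
    have h1 : ¬ (k = 0 ∨ n < k) := by omega
    simp only [hd, if_neg h1]
    exact if_pos ⟨j, hk⟩
  have hpos : ∀ k, 1 ≤ k → k ≤ n → ¬ N k → d k = (((n : ℝ) + 1) ^ k)⁻¹ := by
    intro k h1 h2 h3
    have h1 : ¬ (k = 0 ∨ n < k) := by omega
    simp only [hd, if_neg h1, if_neg h3]
  have hyn : (y : ℝ) ≤ n := by exact_mod_cast hy
  have hxn : (x : ℝ) ≤ n := by exact_mod_cast hx
  have hz0 : (0 : ℝ) ≤ z := Nat.cast_nonneg _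
  have hp : (0 : ℝ) < ((n : ℝ) + 1) ^ x := by positivity
  have hp' : (0 : ℝ) < ((n : ℝ) + 1) ^ (x + 1) := by positivity
  rcases hzy.lt_or_eq with hlt | rfl
  · have hyz : (1 : ℝ) ≤ (y : ℝ) - z := by
      have : ((z + 1 : ℕ) : ℝ) ≤ y := by exact_mod_cast hlt
      push_cast at this; linarith
    rcases hzx.lt_or_eq with hzx' | rfl
    · have hxz : (1 : ℝ) ≤ (x : ℝ) - z := by
        have : ((z + 1 : ℕ) : ℝ) ≤ x := by exact_mod_cast hzx'
        push_cast at this; linarith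
      by_cases hNx : N x
      · have hNx' : N (x + 1) := hNx.imp fun j hj => hj.step ht hlt
        rw [hneg _ hNx, hneg _ hNx', pow_succ]
        have : (x : ℝ) - z < (n + 1) * ((y : ℝ) - z) := by nlinarith
        have := mul_lt_mul_of_pos_left this hp
        linarith
      · have hdx := hpos x (by omega) hx hNx
        have hi : (0 : ℝ) < (((n : ℝ) + 1) ^ x)⁻¹ := inv_pos.2 hp
        have hi' : (0 : ℝ) < (((n : ℝ) + 1) ^ (x + 1))⁻¹ := inv_pos.2 hp'
        by_cases hNx' : N (x + 1)
        · rw [hdx, hneg _ hNx']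
          nlinarith [mul_pos hi (zero_lt_one.trans_le hxz), mul_pos hp' (zero_lt_one.trans_le hyz)]
        · rw [hdx, hpos (x + 1) (by omega) (by omega) hNx']
          have he : (((n : ℝ) + 1) ^ x)⁻¹ = (((n : ℝ) + 1) ^ (x + 1))⁻¹ * (n + 1) := by
            rw [pow_succ]; field_simp
          rw [he]
          have : (y : ℝ) - z < (n + 1) * ((x : ℝ) - z) := by nlinarith
          have := mul_lt_mul_of_pos_left this hi'
          linarith
    · have hNx' : N (z + 1) := ⟨z, .start ht hlt⟩
      rw [hneg _ hNx']
      nlinarith [mul_pos hp' (zero_lt_one.trans_le hyz)]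
  · rcases hzx.lt_or_eq with hzx' | rfl
    · have hxz : (0 : ℝ) < (x : ℝ) - z := sub_pos.2 (by exact_mod_cast hzx')
      have hNx : ¬ N x := fun ⟨j, hj⟩ => hno j x z hj hzx' ht
      rw [hpos x (by omega) hx hNx, sub_self, mul_zero, sub_zero]
      exact mul_pos (inv_pos.2 hp) hxz
    · have h1 := hb.total_pos (x := z) (by omega) hx
      simp only [slack, sub_self, mul_zero] at hs
      nlinarith

/-- The structure of optimal solutions used to build games with a bad unique equilibrium. -/
lemma FeasPoA.exists_tight_of_optimal (hb : IsBasisFun n b) (hn : 0 < n)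
    (hF : FeasPoA n b F ρ) (hopt : ∀ F' ρ', FeasPoA n b F' ρ' → ρ' ≤ ρ) :
    ∃ x y : ℕ, y < x ∧ x ≤ n ∧ F x * ((x : ℝ) - y) = ρ * (b x * x) - b y * y ∧ F 1 = b 1 ∧
      ∀ k ≤ x, F k ≤ F x := by
  have hF1 := hF.apply_one_le hb hn
  rcases (hF.le_one hb hn).lt_or_eq with hρ | rfl
  · obtain ⟨j, x, y, hc, hyx, ht⟩ := hF.exists_chain hb hρ hopt
    obtain rfl := hc.start_eq_zero hb hF hρ hyx ht
    refine ⟨x, y, hyx, hc.bounds.2, ?_, ?_, fun k hk => hc.le hb hF hρ (Nat.zero_le k) hk⟩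
    · have := ht.2
      simp only [slack, sub_self, mul_zero] at this
      linarith
    · obtain ⟨w, hw, htw⟩ := hc.exists_start
      have h1 := htw.2
      simp only [slack, hF.1, hb.zero] at h1
      have hw0 : (0 : ℝ) < w := by exact_mod_cast hw
      have h2 : F 1 = b w := by
        refine mul_right_cancel₀ hw0.ne' ?_
        norm_num at h1
        linarith
      exact le_antisymm hF1 (h2 ▸ hb.monotone hw htw.1.2.1)
  · have h := hF.slack_nonneg (x := 1) (y := 0) (z := 0)
      ⟨hn, by omega, by omega, by omega, by omega, by omega⟩
    simp only [slack, hb.zero] at h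
    norm_num at h
    have h1 : F 1 = b 1 := le_antisymm hF1 h
    refine ⟨1, 0, one_pos, hn, by simp [h1], h1, fun k hk => ?_⟩
    obtain rfl | rfl : k = 0 ∨ k = 1 := by omega
    · rw [hF.1, h1]; exact hb.nonneg hn
    · exact le_rfl

end LinearProgram

namespace CGame

variable {G : CGame}

lemma finite_socialCosts : {c | ∃ a, G.IsAssign a ∧ G.SC a = c}.Finite :=
  (Set.toFinite {a | G.IsAssign a}).image G.SC

lemma exists_isAssign (G : CGame) : ∃ a, G.IsAssign a :=
  ⟨fun i => (G.act_ne i).choose, fun i => (G.act_ne i).choose_spec⟩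

lemma exists_SC_eq_minCost (G : CGame) : ∃ a, G.IsAssign a ∧ G.SC a = G.MinCost :=
  Set.Nonempty.csInf_mem (s := {c | ∃ a, G.IsAssign a ∧ G.SC a = c})
    (G.exists_isAssign.elim fun a ha => ⟨_, a, ha, rfl⟩) finite_socialCosts

lemma minCost_le {a : G.Assign} (ha : G.IsAssign a) : G.MinCost ≤ G.SC a :=
  csInf_le finite_socialCosts.bddBelow ⟨a, ha, rfl⟩

lemma load_le (a : G.Assign) (e : Fin G.R) : G.load a e ≤ G.n :=
  (Finset.card_le_univ _).trans (by simp)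

lemma load_pos {a : G.Assign} {i : Fin G.n} {e : Fin G.R} (h : e ∈ a i) : 1 ≤ G.load a e :=
  Finset.card_pos.2 ⟨i, by simp [h]⟩

lemma sum_sum_eq_sum_filter (a : G.Assign) (g : Fin G.n → Fin G.R → ℝ) :
    ∑ i, ∑ e ∈ a i, g i e = ∑ e, ∑ i with e ∈ a i, g i e :=
  Finset.sum_comm' (by simp)

lemma sum_sum_eq_sum_load (a : G.Assign) (g : Fin G.R → ℝ) :
    ∑ i, ∑ e ∈ a i, g e = ∑ e, G.load a e * g e := by
  rw [sum_sum_eq_sum_filter a fun _ e => g e]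
  simp [load]

/-- The load on `e` caused by the users other than `i`. -/
def loadOthers (a : G.Assign) (i : Fin G.n) (e : Fin G.R) : ℕ :=
  (Finset.univ.filter fun k => k ≠ i ∧ e ∈ a k).card

lemma load_of_mem {a : G.Assign} {i : Fin G.n} {e : Fin G.R} (h : e ∈ a i) :
    G.load a e = loadOthers a i e + 1 := by
  have : (Finset.univ.filter fun k => e ∈ a k)
      = insert i (Finset.univ.filter fun k => k ≠ i ∧ e ∈ a k) := by
    ext k
    by_cases hk : k = i <;> simp [hk, h]
  rw [load, this, Finset.card_insert_of_notMem (by simp), loadOthers]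

lemma load_of_notMem {a : G.Assign} {i : Fin G.n} {e : Fin G.R} (h : e ∉ a i) :
    G.load a e = loadOthers a i e := by
  rw [load, loadOthers]
  congr 1
  ext k
  by_cases hk : k = i <;> simp [hk, h]

lemma loadOthers_update (a : G.Assign) (i : Fin G.n) (s : Finset (Fin G.R)) (e : Fin G.R) :
    loadOthers (Function.update a i s) i e = loadOthers a i e := by
  rw [loadOthers, loadOthers]
  congr 1
  ext k
  by_cases hk : k = i <;> simp [hk]

lemma load_update_of_mem {a : G.Assign} {i : Fin G.n} {s : Finset (Fin G.R)} {e : Fin G.R}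
    (h : e ∈ s) : G.load (Function.update a i s) e = loadOthers a i e + 1 := by
  rw [load_of_mem (i := i) (by simpa using h), loadOthers_update]

lemma potential_eq (a : G.Assign) (i : Fin G.n) :
    G.potential a = ∑ e, ∑ k ∈ Finset.Icc 1 (loadOthers a i e), (G.cost e k + G.tax e k)
      + G.userCost i a := by
  rw [potential, userCost, ← Finset.sum_filter_add_sum_filter_not Finset.univ (· ∈ a i),
    ← Finset.sum_filter_add_sum_filter_not Finset.univ (· ∈ a i)
      (fun e => ∑ k ∈ Finset.Icc 1 (loadOthers a i e), (G.cost e k + G.tax e k))]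
  have h1 : ∑ e with e ∈ a i, ∑ k ∈ Finset.Icc 1 (G.load a e), (G.cost e k + G.tax e k)
      = ∑ e with e ∈ a i, ∑ k ∈ Finset.Icc 1 (loadOthers a i e), (G.cost e k + G.tax e k)
        + ∑ e ∈ a i, (G.cost e (G.load a e) + G.tax e (G.load a e)) := by
    rw [Finset.filter_univ_mem, ← Finset.sum_add_distrib]
    refine Finset.sum_congr rfl fun e he => ?_
    rw [load_of_mem he, Finset.sum_Icc_succ_top (by omega)]
  have h2 : ∑ e with e ∉ a i, ∑ k ∈ Finset.Icc 1 (G.load a e), (G.cost e k + G.tax e k)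
      = ∑ e with e ∉ a i, ∑ k ∈ Finset.Icc 1 (loadOthers a i e), (G.cost e k + G.tax e k) :=
    Finset.sum_congr rfl fun e he => by rw [load_of_notMem (Finset.mem_filter.1 he).2]
  rw [h1, h2]
  ring

/-- Rosenthal: minimizers of the potential are pure Nash equilibria. -/
lemma exists_isNE (G : CGame) : ∃ a, G.IsNE a := by
  obtain ⟨a, ha, hmin⟩ := Set.exists_min_image {a | G.IsAssign a} G.potential
    (Set.toFinite _) G.exists_isAssign
  refine ⟨a, ha, fun i s hs => ?_⟩
  have hu : G.IsAssign (Function.update a i s) := by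
    intro k
    by_cases hk : k = i
    · subst hk; simpa using hs
    · simpa [hk] using ha k
  have h := hmin _ hu
  rw [potential_eq a i, potential_eq (Function.update a i s) i] at h
  simp only [loadOthers_update] at h
  linarith

/-- Summing the equilibrium conditions for deviations to `a'`, resource by resource. -/
lemma IsNE.sum_load_le {a : G.Assign} (ha : G.IsNE a) {a' : G.Assign} (ha' : G.IsAssign a') :
    ∃ z : Fin G.R → ℕ, (∀ e, z e ≤ G.load a e ∧ z e ≤ G.load a' e ∧
      G.load a e + G.load a' e - z e ≤ G.n) ∧
      ∑ e, (G.cost e (G.load a e) + G.tax e (G.load a e)) * ((G.load a e : ℝ) - z e)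
        ≤ ∑ e, (G.cost e (G.load a e + 1) + G.tax e (G.load a e + 1))
          * ((G.load a' e : ℝ) - z e) := by
  set z : Fin G.R → ℕ := fun e => (Finset.univ.filter fun i => e ∈ a' i ∧ e ∈ a i).card with hz
  have hzc : ∀ e, ((Finset.univ.filter fun i => e ∈ a' i).filter fun i => e ∈ a i).card = z e :=
    fun e => by rw [Finset.filter_filter]
  refine ⟨z, fun e => ⟨?_, ?_, ?_⟩, ?_⟩
  · exact Finset.card_le_card fun i => by simp +contextual
  · exact Finset.card_le_card fun i => by simp +contextual
  · have h := Finset.card_union_add_card_inter (Finset.univ.filter fun i => e ∈ a i)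
      (Finset.univ.filter fun i => e ∈ a' i)
    have h1 : (Finset.univ.filter fun i => e ∈ a i) ∩ (Finset.univ.filter fun i => e ∈ a' i)
        = Finset.univ.filter fun i => e ∈ a' i ∧ e ∈ a i := by
      ext i; simp [and_comm]
    have h2 := Finset.card_le_univ ((Finset.univ.filter fun i => e ∈ a i) ∪
      (Finset.univ.filter fun i => e ∈ a' i))
    rw [h1] at h
    rw [Fintype.card_fin] at h2
    simp only [load, hz]
    omega
  · set f : Fin G.R → ℕ → ℝ := fun e k => G.cost e k + G.tax e k with hf
    have hsum : ∑ i, G.userCost i a ≤ ∑ i, G.userCost i (Function.update a i (a' i)) :=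
      Finset.sum_le_sum fun i _ => ha.2 i _ (ha' i)
    have hl : ∑ i, G.userCost i a = ∑ e, G.load a e * f e (G.load a e) :=
      sum_sum_eq_sum_load a fun e => f e (G.load a e)
    have hr : ∑ i, G.userCost i (Function.update a i (a' i))
        = ∑ e, (z e * f e (G.load a e) + ((G.load a' e : ℝ) - z e) * f e (G.load a e + 1)) := by
      have h1 : ∀ i, G.userCost i (Function.update a i (a' i))
          = ∑ e ∈ a' i, if e ∈ a i then f e (G.load a e) else f e (G.load a e + 1) := by
        intro i
        rw [userCost, Function.update_self]
        refine Finset.sum_congr rfl fun e he => ?_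
        rw [load_update_of_mem he]
        split_ifs with h
        · rw [load_of_mem h]
        · rw [load_of_notMem h]
      simp only [h1]
      rw [sum_sum_eq_sum_filter a' fun i e =>
        if e ∈ a i then f e (G.load a e) else f e (G.load a e + 1)]
      refine Finset.sum_congr rfl fun e _ => ?_
      rw [Finset.sum_ite, Finset.sum_const, Finset.sum_const, hzc, nsmul_eq_mul, nsmul_eq_mul]
      have h2 := Finset.card_filter_add_card_filter_not
        (s := Finset.univ.filter fun i => e ∈ a' i) (fun i => e ∈ a i)
      rw [hzc] at h2
      have h3 : ((((Finset.univ.filter fun i => e ∈ a' i).filter fun i => ¬ e ∈ a i).card : ℕ) : ℝ)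
          = (G.load a' e : ℝ) - z e := by
        rw [load, ← h2]; push_cast; ring
      rw [h3]
    rw [hl, hr] at hsum
    rw [← sub_nonneg, ← Finset.sum_sub_distrib] at hsum ⊢
    refine hsum.trans_eq (Finset.sum_congr rfl fun e _ => ?_)
    ring

end CGame

section Mechanism

variable {n m : ℕ} {b : Fin m → ℕ → ℝ} {F : Fin m → ℕ → ℝ} {T : Mech}

lemma InClass.exists_coeff {G : CGame} (hG : InClass n m b T G)
    (hT : ∀ α : Fin m → ℝ, (∀ j, 0 ≤ α j) →
      ∀ x, T (fun y => ∑ j, α j * b j y) x = ∑ j, α j * (F j x - b j x)) (e : Fin G.R) :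
    ∃ α : Fin m → ℝ, (∀ j, 0 ≤ α j) ∧ (∀ x, G.cost e x = ∑ j, α j * b j x) ∧
      ∀ x, G.cost e x + G.tax e x = ∑ j, α j * F j x := by
  obtain ⟨α, hα, hc⟩ := hG.2.1 e
  refine ⟨α, hα, hc, fun x => ?_⟩
  rw [hG.2.2 e x, show G.cost e = fun y => ∑ j, α j * b j y from funext hc, hT α hα,
    ← Finset.sum_add_distrib]
  exact Finset.sum_congr rfl fun j _ => by ring

/-- The smoothness bound: an equilibrium costs at most `1/ρ` times any other assignment. -/
lemma InClass.mul_SC_le {G : CGame} (hG : InClass n m b T G)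
    (hT : ∀ α : Fin m → ℝ, (∀ j, 0 ≤ α j) →
      ∀ x, T (fun y => ∑ j, α j * b j y) x = ∑ j, α j * (F j x - b j x))
    (hb : ∀ j, IsBasisFun n (b j)) {ρ : ℝ} {r : Fin m → ℝ} (hr : ∀ j, ρ ≤ r j)
    (hF : ∀ j, FeasPoA n (b j) (F j) (r j)) {a a' : G.Assign} (ha : G.IsNE a)
    (ha' : G.IsAssign a') : ρ * G.SC a ≤ G.SC a' := by
  obtain ⟨z, hz, hle⟩ := ha.sum_load_le ha'
  have hSC : ∀ a : G.Assign, G.SC a = ∑ e, G.load a e * G.cost e (G.load a e) := fun a =>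
    CGame.sum_sum_eq_sum_load a fun e => G.cost e (G.load a e)
  have key : ∀ e, 0 ≤ G.load a' e * G.cost e (G.load a' e)
      - ρ * (G.load a e * G.cost e (G.load a e))
      + (G.cost e (G.load a e) + G.tax e (G.load a e)) * ((G.load a e : ℝ) - z e)
      - (G.cost e (G.load a e + 1) + G.tax e (G.load a e + 1)) * ((G.load a' e : ℝ) - z e) := by
    intro e
    obtain ⟨α, hα, hc, hf⟩ := hG.exists_coeff hT e
    obtain ⟨h1, h2, h3⟩ := hz e
    have hx := (CGame.load_le a e).trans hG.1
    have hy := (CGame.load_le a' e).trans hG.1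
    have hGn := hG.1
    rw [hf, hf, hc, hc]
    have : 0 ≤ ∑ j, α j * slack (b j) (F j) ρ (G.load a e) (G.load a' e) (z e) := by
      refine Finset.sum_nonneg fun j _ => mul_nonneg (hα j) ?_
      rcases Nat.eq_zero_or_pos (G.load a e + G.load a' e - z e) with h | h
      · have e1 : G.load a e = 0 := by omega
        have e2 : G.load a' e = 0 := by omega
        have e3 : z e = 0 := by omega
        simp [slack, e1, e2, e3]
      · have h4 := (hF j).slack_nonneg (x := G.load a e) (y := G.load a' e) (z := z e)
          ⟨hx, hy, h1, h2, h, by omega⟩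
        have h5 := mul_le_mul_of_nonneg_right (hr j) ((hb j).total_nonneg hx)
        simp only [slack] at h4 ⊢
        linarith
    refine this.trans_eq ?_
    simp only [slack, Finset.mul_sum, Finset.sum_mul]
    rw [← Finset.sum_sub_distrib, ← Finset.sum_add_distrib, ← Finset.sum_sub_distrib]
    exact Finset.sum_congr rfl fun j _ => by ring
  have hsum := Finset.sum_nonneg fun e (_ : e ∈ Finset.univ) => key e
  rw [Finset.sum_sub_distrib, Finset.sum_add_distrib, Finset.sum_sub_distrib,
    ← Finset.mul_sum] at hsum
  rw [hSC, hSC]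
  linarith

lemma PoS_le_PoA : PoS n m b T ≤ PoA n m b T := by
  refine iSup_mono fun G => iSup_mono fun _ => ?_
  obtain ⟨a, ha⟩ := G.exists_isNE
  exact (iInf_le _ ⟨a, ha⟩).trans
    (le_iSup₂ (f := fun a (_ : G.IsNE a) => ENNReal.ofReal (G.SC a / G.MinCost)) a ha)

lemma PoA_le (hm : 0 < m)
    (hT : ∀ α : Fin m → ℝ, (∀ j, 0 ≤ α j) →
      ∀ x, T (fun y => ∑ j, α j * b j y) x = ∑ j, α j * (F j x - b j x))
    (hb : ∀ j, IsBasisFun n (b j)) {r : Fin m → ℝ} (hr : ∀ j, 0 < r j)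
    (hF : ∀ j, FeasPoA n (b j) (F j) (r j)) :
    PoA n m b T ≤ ⨆ j, ENNReal.ofReal (1 / r j) := by
  have : Nonempty (Fin m) := ⟨⟨0, hm⟩⟩
  obtain ⟨j, hj⟩ := Finite.exists_min r
  refine iSup_le fun G => iSup_le fun hG => iSup_le fun a => iSup_le fun ha =>
    le_iSup_of_le j (ENNReal.ofReal_le_ofReal ?_)
  obtain ⟨a', ha', he⟩ := G.exists_SC_eq_minCost
  have h := hG.1.mul_SC_le hT hb hj hF ha ha'
  rw [he] at h
  rw [div_le_div_iff₀ hG.2 (hr j)]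
  linarith

end Mechanism

/-- The game with `x` users who can all share resource `0`, in which every user `i ≥ y` also has a
private resource `i + 1` whose cost is scaled by `w`. -/
abbrev sharedGame (T : Mech) (b : ℕ → ℝ) (x y : ℕ) (w : ℝ) : CGame where
  n := x
  R := x + 1
  act i := if (i : ℕ) < y then {{0}} else {{0}, {i.succ}}
  act_ne i := by split_ifs <;> simp
  cost e k := (if e = 0 then 1 else w) * b k
  tax e k := T (fun k => (if e = 0 then 1 else w) * b k) k

namespace sharedGame

variable {n m : ℕ} {b : Fin m → ℕ → ℝ} {F : Fin m → ℕ → ℝ} {T : Mech} {j : Fin m} {x y : ℕ}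
  {w : ℝ}

lemma coeff_nonneg (hw : 0 ≤ w) (e : Fin (x + 1)) (i : Fin m) :
    0 ≤ (Pi.single j (if e = 0 then 1 else w) : Fin m → ℝ) i := by
  have h : (0 : ℝ) ≤ if e = 0 then 1 else w := by split_ifs <;> simp [hw]
  exact (Pi.single_nonneg (α := fun _ : Fin m => ℝ)).2 h i

lemma sum_coeff_mul (e : Fin (x + 1)) (g : Fin m → ℝ) :
    ∑ i, (Pi.single j (if e = 0 then 1 else w) : Fin m → ℝ) i * g i
      = (if e = 0 then 1 else w) * g j := by
  rw [Finset.sum_eq_single j (fun i _ h => by simp [h]) (by simp), Pi.single_eq_same]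

lemma inClass (hx : x ≤ n) (hw : 0 ≤ w) : InClass n m b T (sharedGame T (b j) x y w) :=
  ⟨hx, fun e => ⟨Pi.single j (if e = 0 then 1 else w), coeff_nonneg hw e,
    fun k => (sum_coeff_mul e fun i => b i k).symm⟩, fun _ _ => rfl⟩

lemma cost_add_tax (hw : 0 ≤ w)
    (hT : ∀ α : Fin m → ℝ, (∀ j, 0 ≤ α j) →
      ∀ x, T (fun y => ∑ j, α j * b j y) x = ∑ j, α j * (F j x - b j x))
    (e : Fin (x + 1)) (k : ℕ) :
    (sharedGame T (b j) x y w).cost e k + (sharedGame T (b j) x y w).tax e k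
      = (if e = 0 then 1 else w) * F j k := by
  have h := hT (Pi.single j (if e = 0 then 1 else w)) (coeff_nonneg hw e) k
  simp only [sum_coeff_mul] at h
  change (if e = 0 then 1 else w) * b j k + T (fun k => (if e = 0 then 1 else w) * b j k) k = _
  rw [h]
  ring

lemma eq_or_eq {b : ℕ → ℝ} {a : (sharedGame T b x y w).Assign}
    (ha : (sharedGame T b x y w).IsAssign a) (i : Fin x) :
    a i = {0} ∨ a i = {i.succ} := by
  have h := ha i
  simp only [sharedGame] at h
  split_ifs at h
  · exact .inl (Finset.mem_singleton.1 h)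
  · simpa using h

/-- Sharing resource `0` is dominant when private resources are too expensive. -/
lemma eq_of_isNE (hw : 0 ≤ w)
    (hT : ∀ α : Fin m → ℝ, (∀ j, 0 ≤ α j) →
      ∀ x, T (fun y => ∑ j, α j * b j y) x = ∑ j, α j * (F j x - b j x))
    (hlt : ∀ k ≤ x, F j k < w * F j 1) {a : (sharedGame T (b j) x y w).Assign}
    (ha : (sharedGame T (b j) x y w).IsNE a) (i : Fin x) : a i = {0} := by
  rcases eq_or_eq ha.1 i with h | h
  · exact h
  exfalso
  have hact : {0} ∈ (sharedGame T (b j) x y w).act i := by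
    simp only [sharedGame]
    split_ifs <;> simp
  have hne := ha.2 i {0} hact
  have hload : (sharedGame T (b j) x y w).load a i.succ = 1 := by
    rw [CGame.load, Finset.card_eq_one]
    refine ⟨i, ?_⟩
    ext k
    rw [Finset.mem_filter, Finset.mem_singleton]
    refine ⟨fun ⟨_, hk⟩ => ?_, fun hk => ?_⟩
    · rcases eq_or_eq ha.1 k with h' | h'
      · rw [h'] at hk
        exact absurd (Finset.mem_singleton.1 hk) (Fin.succ_ne_zero i)
      · rw [h'] at hk
        exact (Fin.succ_injective _ (Finset.mem_singleton.1 hk)).symm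
    · subst hk
      rw [h]
      simp
  have h1 : (sharedGame T (b j) x y w).userCost i a = w * F j 1 := by
    rw [CGame.userCost, h, Finset.sum_singleton, hload, cost_add_tax hw hT,
      if_neg (Fin.succ_ne_zero i)]
  have h2 : (sharedGame T (b j) x y w).userCost i (Function.update a i {0})
      = F j ((sharedGame T (b j) x y w).load (Function.update a i {0}) 0) := by
    rw [CGame.userCost, Function.update_self, Finset.sum_singleton, cost_add_tax hw hT,
      if_pos rfl, one_mul]
  rw [h1, h2] at hne
  exact absurd (hlt _ (CGame.load_le _ _)) hne.not_gt

lemma SC_shared {b : ℕ → ℝ} {a : (sharedGame T b x y w).Assign} (ha : ∀ i : Fin x, a i = {0}) :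
    (sharedGame T b x y w).SC a = b x * x := by
  have hload : (sharedGame T b x y w).load a 0 = x := by
    have : (Finset.univ.filter fun i : Fin x => (0 : Fin (x + 1)) ∈ a i) = Finset.univ := by
      ext i; simp [ha]
    change (Finset.univ.filter fun i : Fin x => (0 : Fin (x + 1)) ∈ a i).card = x
    rw [this]; simp
  have h : ∀ i : Fin x, ∑ e ∈ a i, (sharedGame T b x y w).cost e
      ((sharedGame T b x y w).load a e) = b x := by
    intro i
    rw [ha i, Finset.sum_singleton, hload]
    simp
  change ∑ i : Fin x, _ = _
  rw [Finset.sum_congr rfl fun i _ => h i]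
  simp [mul_comm]

lemma minCost_le {b : ℕ → ℝ} (hyx : y ≤ x) :
    (sharedGame T b x y w).MinCost ≤ b y * y + ((x : ℝ) - y) * (w * b 1) := by
  set a : (sharedGame T b x y w).Assign :=
    fun i : Fin x => if (i : ℕ) < y then {0} else {i.succ} with ha
  have hassign : (sharedGame T b x y w).IsAssign a := by
    intro i
    simp only [ha, sharedGame]
    split_ifs <;> simp
  have hcard : (Finset.univ.filter fun i : Fin x => (i : ℕ) < y).card = y := by
    simpa [hyx] using Fin.card_filter_val_lt (n := x) (m := y)
  have hload0 : (sharedGame T b x y w).load a 0 = y := by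
    refine Eq.trans ?_ hcard
    change (Finset.univ.filter fun i : Fin x => (0 : Fin (x + 1)) ∈ a i).card = _
    congr 1
    ext i
    by_cases h : (i : ℕ) < y
    · simp [ha, h]
    · simp [ha, h, (Fin.succ_ne_zero i).symm]
  have hload1 : ∀ i : Fin x, ¬ (i : ℕ) < y → (sharedGame T b x y w).load a i.succ = 1 := by
    intro i hi
    change (Finset.univ.filter fun k : Fin x => (i.succ : Fin (x + 1)) ∈ a k).card = 1
    rw [Finset.card_eq_one]
    refine ⟨i, ?_⟩
    ext k
    by_cases h : (k : ℕ) < y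
    · have hki : k ≠ i := fun e => hi (e ▸ h)
      simp [ha, h, hki, Fin.succ_ne_zero]
    · simp [ha, h, eq_comm]
  have h : ∀ i : Fin x, ∑ e ∈ a i, (sharedGame T b x y w).cost e
      ((sharedGame T b x y w).load a e) = if (i : ℕ) < y then b y else w * b 1 := by
    intro i
    by_cases hi : (i : ℕ) < y
    · have hai : a i = {0} := if_pos hi
      rw [hai, Finset.sum_singleton, hload0, if_pos hi]
      simp
    · have hai : a i = {i.succ} := if_neg hi
      rw [hai, Finset.sum_singleton, hload1 i hi, if_neg hi]
      simp [Fin.succ_ne_zero]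
  refine (CGame.minCost_le hassign).trans_eq ?_
  change ∑ i : Fin x, _ = _
  rw [Finset.sum_congr rfl fun i _ => h i, Finset.sum_ite, Finset.sum_const, Finset.sum_const,
    hcard, nsmul_eq_mul, nsmul_eq_mul]
  have h2 := Finset.card_filter_add_card_filter_not (s := (Finset.univ : Finset (Fin x)))
    (fun i => (i : ℕ) < y)
  rw [hcard, Finset.card_univ, Fintype.card_fin] at h2
  have h3 : ((Finset.univ.filter fun i : Fin x => ¬ (i : ℕ) < y).card : ℝ) = (x : ℝ) - y := by
    rw [eq_sub_iff_add_eq, add_comm]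
    exact_mod_cast h2
  rw [h3]
  ring

lemma minCost_pos {b : ℕ → ℝ} (hb : IsBasisFun n b) (hx0 : 1 ≤ x) (hx : x ≤ n) (hw : 0 < w) :
    0 < (sharedGame T b x y w).MinCost := by
  obtain ⟨a, ha, he⟩ := (sharedGame T b x y w).exists_SC_eq_minCost
  rw [← he]
  refine Finset.sum_pos (fun i _ => Finset.sum_pos (fun e hei => ?_) ?_) ⟨⟨0, hx0⟩, by simp⟩
  · refine mul_pos (by split_ifs <;> simp [hw]) (hb.pos _ (CGame.load_pos hei) ?_)
    exact (CGame.load_le a e).trans hx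
  · rcases eq_or_eq ha i with h | h <;> rw [h] <;> simp

end sharedGame

section LowerBound

variable {n m : ℕ} {b : Fin m → ℕ → ℝ} {F : Fin m → ℕ → ℝ} {T : Mech}

lemma le_PoS (hn : 0 < n)
    (hT : ∀ α : Fin m → ℝ, (∀ j, 0 ≤ α j) →
      ∀ x, T (fun y => ∑ j, α j * b j y) x = ∑ j, α j * (F j x - b j x))
    {j : Fin m} (hb : IsBasisFun n (b j)) {ρ : ℝ} (hρ : 0 < ρ) (hF : FeasPoA n (b j) (F j) ρ)
    (hopt : ∀ F' ρ', FeasPoA n (b j) F' ρ' → ρ' ≤ ρ) :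
    ENNReal.ofReal (1 / ρ) ≤ PoS n m b T := by
  obtain ⟨x, y, hyx, hxn, htight, hF1, hmax⟩ := hF.exists_tight_of_optimal hb hn hopt
  have hb1 := hb.pos 1 le_rfl hn
  have hFx : 0 < F j x := hb1.trans_le (hF1 ▸ hmax 1 (by omega))
  have hcx := hb.total_pos (x := x) (by omega) hxn
  have hxy : (0 : ℝ) < (x : ℝ) - y := sub_pos.2 (by exact_mod_cast hyx)
  set D : ℝ → ℝ := fun ε => ρ * (b j x * x) + ε * (((x : ℝ) - y) * F j x) with hD
  have hbound : ∀ ε : ℝ, 0 < ε → ENNReal.ofReal (b j x * x / D ε) ≤ PoS n m b T := by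
    intro ε hε
    have hw : 0 < (1 + ε) * F j x / b j 1 := by positivity
    have hw1 : (1 + ε) * F j x / b j 1 * b j 1 = (1 + ε) * F j x := div_mul_cancel₀ _ hb1.ne'
    have hpos : 0 < (sharedGame T (b j) x y ((1 + ε) * F j x / b j 1)).MinCost :=
      sharedGame.minCost_pos hb (by omega) hxn hw
    have hle := sharedGame.minCost_le (T := T) (w := (1 + ε) * F j x / b j 1) (b := b j) hyx.le
    refine le_iSup₂_of_le (sharedGame T (b j) x y ((1 + ε) * F j x / b j 1))
      ⟨sharedGame.inClass hxn hw.le, hpos⟩ (le_iInf fun a => ENNReal.ofReal_le_ofReal ?_)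
    rw [sharedGame.SC_shared (sharedGame.eq_of_isNE hw.le hT (fun k hk => ?_) a.2)]
    · refine div_le_div_of_nonneg_left hcx.le hpos (hle.trans_eq ?_)
      rw [hw1]
      simp only [hD]
      linarith
    · rw [hF1, hw1]
      exact (hmax k hk).trans_lt (by nlinarith)
  have hlim : Filter.Tendsto (fun ε => ENNReal.ofReal (b j x * x / D ε))
      (nhdsWithin 0 (Set.Ioi 0)) (nhds (ENNReal.ofReal (1 / ρ))) := by
    refine (ENNReal.continuous_ofReal.tendsto _).comp ?_
    have hD0 : D 0 ≠ 0 := by simp only [hD, zero_mul, add_zero]; positivity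
    have hc : ContinuousAt (fun ε => b j x * x / D ε) 0 :=
      continuousAt_const.div (by simp only [hD]; fun_prop) hD0
    have hv : b j x * x / D 0 = 1 / ρ := by
      simp only [hD, zero_mul, add_zero]
      rw [div_eq_div_iff (by positivity) hρ.ne']
      ring
    rw [← hv]
    exact hc.tendsto.mono_left nhdsWithin_le_nhds
  exact le_of_tendsto hlim (by filter_upwards [self_mem_nhdsWithin] with ε hε using hbound ε hε)

end LowerBound

/-- Over congestion games with at most `n` users and costs
generated by positive, convex, nondecreasing basis functions `b_1, …, b_m`, if
for each `j` the pair `(F*_j, ρ*_j)` is an optimal solution of the linear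
program of Proposition 2.1, then the linear local mechanism `T*` defined by
`T*(Σ_j α_j b_j) = Σ_j α_j (F*_j − b_j)` satisfies
`PoS(T*) = PoA(T*) = max_j 1/ρ*_j`. -/
theorem optimal_PoA_mechanism_PoS_eq_PoA
    (n m : ℕ) (hn : 0 < n) (hm : 0 < m)
    (b : Fin m → ℕ → ℝ)
    (hb0 : ∀ j, b j 0 = 0)
    (hbpos : ∀ j, ∀ x : ℕ, 1 ≤ x → x ≤ n → 0 < b j x)
    (hbmono : ∀ j, ∀ x : ℕ, 1 ≤ x → x < n → b j x ≤ b j (x + 1))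
    (hbconv : ∀ j, ∀ x : ℕ, 1 ≤ x → x + 1 ≤ n →
      b j x - b j (x - 1) ≤ b j (x + 1) - b j x)
    (Fstar : Fin m → ℕ → ℝ) (ρstar : Fin m → ℝ)
    (hfeas : ∀ j, FeasPoA n (b j) (Fstar j) (ρstar j))
    (hopt : ∀ j, ∀ F : ℕ → ℝ, ∀ ρ : ℝ, FeasPoA n (b j) F ρ → ρ ≤ ρstar j)
    (Tstar : Mech)
    (hTstar : ∀ α : Fin m → ℝ, (∀ j, 0 ≤ α j) →
      ∀ x, Tstar (fun y => ∑ j, α j * b j y) x = ∑ j, α j * (Fstar j x - b j x)) :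
    PoS n m b Tstar = PoA n m b Tstar ∧
    PoA n m b Tstar = ⨆ j : Fin m, ENNReal.ofReal (1 / ρstar j) := by
  have hb : ∀ j, IsBasisFun n (b j) := fun j => ⟨hb0 j, hbpos j, hbmono j, hbconv j⟩
  have hρ : ∀ j, 0 < ρstar j := fun j =>
    let ⟨F, ρ, hpos, hF⟩ := exists_feasPoA_pos (hb j) hn
    hpos.trans_le (hopt j F ρ hF)
  have hupper := PoA_le hm hTstar hb hρ hfeas
  have hlower : ⨆ j, ENNReal.ofReal (1 / ρstar j) ≤ PoS n m b Tstar :=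
    iSup_le fun j => le_PoS hn hTstar (hb j) (hρ j) (hfeas j) (hopt j)
  exact ⟨le_antisymm PoS_le_PoA (hupper.trans hlower),
    le_antisymm hupper (hlower.trans PoS_le_PoA)⟩
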